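/- arXiv:2103.07445 — 2 statements merged into one kernel-verified Lean document; each statement's English description precedes it below -/
import Mathlib

section
/- Let f = G·(T_1 + T_2), where G, T_1, T_2 ∈ F[x_1,…,x_n] are products of linear forms, T_1 and T_2 are homogeneous of equal degree at most d (with d ≥ 1), T_1 and T_2 have no common linear factor (gcd(T_1,T_2) = 1), and the linear factors of T_1·T_2 span an F-subspace of dimension at least 5. Then the number of codimension-2 subspaces W ∈ S(NonLin(f)) on which neither T_1 nor T_2 vanishes (i.e. T_1 ∉ ideal of W and T_2 ∉ ideal of W) is at most d^5 + d^7. -/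
open MvPolynomial

/-- A linear form: a nonzero homogeneous degree-1 polynomial. -/
def IsLinearForm {F : Type*} [Field F] {n : ℕ} (ℓ : MvPolynomial (Fin n) F) : Prop :=
  ℓ ≠ 0 ∧ ℓ.IsHomogeneous 1

/-- A product of linear forms (a nonzero scalar multiple of a product of linear forms). -/
def IsProdLinearForms {F : Type*} [Field F] {n : ℕ} (g : MvPolynomial (Fin n) F) : Prop :=
  ∃ (c : F) (L : Multiset (MvPolynomial (Fin n) F)),
    c ≠ 0 ∧ (∀ p ∈ L, IsLinearForm p) ∧ g = c • L.prod

/-- `g` has no linear factors. -/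
def NoLinearFactor {F : Type*} [Field F] {n : ℕ} (g : MvPolynomial (Fin n) F) : Prop :=
  ∀ ℓ : MvPolynomial (Fin n) F, IsLinearForm ℓ → ¬ ℓ ∣ g

/-- `h` is the non-linear part `NonLin(f)` of `f` (up to scalars): `h` has no linear
factors and `f` is a product of linear forms times `h`. -/
def IsNonLinPart {F : Type*} [Field F] {n : ℕ} (f h : MvPolynomial (Fin n) F) : Prop :=
  NoLinearFactor h ∧ ∃ L : MvPolynomial (Fin n) F, IsProdLinearForms L ∧ f = L * h

/-- `S(g)`: the set of codimension-2 subspaces `V(ℓ₁,ℓ₂)` of `F^n` on which `g`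
vanishes, i.e. `g` belongs to the ideal generated by `ℓ₁, ℓ₂`. -/
def vanishCodim2 {F : Type*} [Field F] {n : ℕ} (g : MvPolynomial (Fin n) F) :
    Set (Set (Fin n → F)) :=
  {W | ∃ ℓ₁ ℓ₂ : MvPolynomial (Fin n) F, IsLinearForm ℓ₁ ∧ IsLinearForm ℓ₂ ∧
    LinearIndependent F ![ℓ₁, ℓ₂] ∧
    W = {a : Fin n → F | eval a ℓ₁ = 0 ∧ eval a ℓ₂ = 0} ∧
    g ∈ Ideal.span {ℓ₁, ℓ₂}}

section LinearAlgebra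

variable {K V : Type*} [Field K] [AddCommGroup V] [Module K V]

theorem span_pair_eq_of_linearIndependent {x y a b : V} (h : LinearIndependent K ![x, y])
    (hx : x ∈ Submodule.span K {a, b}) (hy : y ∈ Submodule.span K {a, b}) :
    Submodule.span K {x, y} = Submodule.span K {a, b} := by
  classical
  have hfin : FiniteDimensional K (Submodule.span K {a, b}) :=
    FiniteDimensional.span_of_finite K (Set.toFinite _)
  refine Submodule.eq_of_le_of_finrank_le ?_ ?_
  · rw [Submodule.span_le]
    rintro z (rfl | rfl)
    exacts [hx, hy]
  · have h1 : Module.finrank K (Submodule.span K (Set.range ![x, y])) = 2 := by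
      simpa using finrank_span_eq_card h
    rw [Matrix.range_cons, Matrix.range_cons, Matrix.range_empty, Set.union_empty,
      Set.singleton_union] at h1
    have h2 := finrank_span_finset_le_card (R := K) ({a, b} : Finset V)
    rw [Finset.coe_pair] at h2
    rw [h1]
    exact h2.trans Finset.card_le_two

/-- A plane not contained in `Q` meets `Q` in at most a line. -/
theorem exists_smul_eq_of_mem_span_pair {Q : Submodule K V} {a b x y : V}
    (hQ : ¬ (a ∈ Q ∧ b ∈ Q)) (hx : x ∈ Submodule.span K {a, b}) (hxQ : x ∈ Q) (hx0 : x ≠ 0)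
    (hy : y ∈ Submodule.span K {a, b}) (hyQ : y ∈ Q) : ∃ c : K, c • x = y := by
  by_contra! hne
  have h := span_pair_eq_of_linearIndependent ((LinearIndependent.pair_iff' hx0).2 hne) hx hy
  have hle : Submodule.span K {a, b} ≤ Q := by
    rw [← h, Submodule.span_le]
    rintro z (rfl | rfl)
    exacts [hxQ, hyQ]
  exact hQ ⟨hle (Submodule.subset_span (by simp)), hle (Submodule.subset_span (by simp))⟩

/-- If a plane `span {p, q}` meets enough planes `span {a, b}` with `a ∈ A`, `b ∈ B` and the rank
of `A ∪ B` is at least five, then some nonzero vector of it lies in the intersection of one such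
plane with the sum of two others, not containing the first. -/
theorem exists_mem_span_inter_of_five_le_finrank {A B : Set V} {p q : V}
    (hA : ∀ a ∈ A, ∃ b ∈ B, ∃ x ≠ 0, x ∈ Submodule.span K {p, q} ∧ x ∈ Submodule.span K {a, b})
    (hB : ∀ b ∈ B, ∃ a ∈ A, ∃ x ≠ 0, x ∈ Submodule.span K {p, q} ∧ x ∈ Submodule.span K {a, b})
    (hrank : 5 ≤ Module.finrank K (Submodule.span K (A ∪ B))) :
    ∃ a₀ ∈ A, ∃ b₀ ∈ B, ∃ a₁ ∈ A, ∃ b₁ ∈ B, ∃ a₂ ∈ A, ∃ b₂ ∈ B,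
      ¬ (a₂ ∈ Submodule.span K {a₀, b₀, a₁, b₁} ∧ b₂ ∈ Submodule.span K {a₀, b₀, a₁, b₁}) ∧
      ∃ x ≠ 0, x ∈ Submodule.span K {p, q} ∧ x ∈ Submodule.span K {a₂, b₂} ∧
        x ∈ Submodule.span K {a₀, b₀, a₁, b₁} := by
  classical
  have hnot (a₀ b₀ a₁ b₁ : V) : ∃ a ∈ A, ∃ b ∈ B, ¬ (a ∈ Submodule.span K {a₀, b₀, a₁, b₁} ∧
      b ∈ Submodule.span K {a₀, b₀, a₁, b₁}) ∧
      ∃ x ≠ 0, x ∈ Submodule.span K {p, q} ∧ x ∈ Submodule.span K {a, b} := by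
    by_contra! hcon
    have hle : Submodule.span K (A ∪ B) ≤ Submodule.span K {a₀, b₀, a₁, b₁} := by
      rw [Submodule.span_le]
      rintro z (hz | hz)
      · obtain ⟨b, hb, x, hx0, hx, hx'⟩ := hA z hz
        by_contra hzQ
        exact hcon z hz b hb (fun h => absurd h hzQ) x hx0 hx hx'
      · obtain ⟨a, ha, x, hx0, hx, hx'⟩ := hB z hz
        by_contra hzQ
        exact hcon a ha z hz (fun _ h => hzQ h) x hx0 hx hx'
    have hfin : FiniteDimensional K (Submodule.span K {a₀, b₀, a₁, b₁}) :=
      FiniteDimensional.span_of_finite K (Set.toFinite _)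
    have h1 := Submodule.finrank_mono hle
    have h2 : Module.finrank K (Submodule.span K {a₀, b₀, a₁, b₁}) ≤ 4 := by
      have := finrank_span_finset_le_card (R := K) ({a₀, b₀, a₁, b₁} : Finset V)
      push_cast at this
      exact this.trans Finset.card_le_four
    omega
  obtain ⟨a₀, ha₀, b₀, hb₀, -, x₀, hx₀, hx₀U, hx₀P⟩ := hnot 0 0 0 0
  have hcover : ∃ a₁ ∈ A, ∃ b₁ ∈ B, ∀ a ∈ A, ∀ b ∈ B, ∀ x, x ∈ Submodule.span K {p, q} →
      x ∈ Submodule.span K {a, b} → x ∈ Submodule.span K {a₀, b₀, a₁, b₁} := by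
    by_cases h : ∃ a₁ ∈ A, ∃ b₁ ∈ B, ∃ x₁, x₁ ∈ Submodule.span K {p, q} ∧
        x₁ ∈ Submodule.span K {a₁, b₁} ∧ LinearIndependent K ![x₀, x₁]
    · obtain ⟨a₁, ha₁, b₁, hb₁, x₁, hx₁U, hx₁P, hind⟩ := h
      refine ⟨a₁, ha₁, b₁, hb₁, fun a _ b _ x hx _ => ?_⟩
      rw [← span_pair_eq_of_linearIndependent hind hx₀U hx₁U] at hx
      refine Submodule.span_le.2 ?_ hx
      rintro z (rfl | rfl)
      · exact Submodule.span_mono (by grind) hx₀P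
      · exact Submodule.span_mono (by grind) hx₁P
    · refine ⟨a₀, ha₀, b₀, hb₀, fun a ha b hb x hx hx' => ?_⟩
      have hdep : ¬ LinearIndependent K ![x₀, x] := fun hi => h ⟨a, ha, b, hb, x, hx, hx', hi⟩
      rw [LinearIndependent.pair_iff' hx₀] at hdep
      push Not at hdep
      obtain ⟨c, rfl⟩ := hdep
      exact Submodule.smul_mem _ _ (Submodule.span_mono (by grind) hx₀P)
  obtain ⟨a₁, ha₁, b₁, hb₁, hQ⟩ := hcover
  obtain ⟨a₂, ha₂, b₂, hb₂, hnQ, x, hx0, hxU, hxP⟩ := hnot a₀ b₀ a₁ b₁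
  exact ⟨a₀, ha₀, b₀, hb₀, a₁, ha₁, b₁, hb₁, a₂, ha₂, b₂, hb₂, hnQ, x, hx0, hxU, hxP,
    hQ a₂ ha₂ b₂ hb₂ x hxU hxP⟩

end LinearAlgebra

section LinearForms

variable {F : Type*} [Field F] {n : ℕ}

theorem IsLinearForm.totalDegree_eq {u : MvPolynomial (Fin n) F} (hu : IsLinearForm u) :
    u.totalDegree = 1 :=
  hu.2.totalDegree hu.1

/-- Elimination of a variable by means of the equation `u = 0`. -/
theorem IsLinearForm.exists_retraction {u : MvPolynomial (Fin n) F} (hu : IsLinearForm u) :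
    ∃ φ : MvPolynomial (Fin n) F →ₐ[F] MvPolynomial (Fin n) F,
      φ u = 0 ∧ (∀ g, u ∣ g - φ g) ∧
      (∀ g, g.IsHomogeneous 1 → (φ g).IsHomogeneous 1 ∧ ∃ c : F, φ g = g - c • u) ∧
      ∀ g, (φ g).totalDegree ≤ g.totalDegree := by
  classical
  have hspan {g : MvPolynomial (Fin n) F} (hg : g.IsHomogeneous 1) :
      g ∈ Submodule.span F (Set.range (X : Fin n → MvPolynomial (Fin n) F)) := by
    rw [← homogeneousSubmodule_one_eq_span_X]
    exact hg
  obtain ⟨p, hp⟩ : ∃ p, coeff (Finsupp.single p 1) u ≠ 0 := by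
    by_contra! h
    have h0 : ∀ g ∈ Submodule.span F (Set.range (X : Fin n → MvPolynomial (Fin n) F)),
        g = ∑ i, coeff (Finsupp.single i 1) g • X i := by
      intro g hg
      induction hg using Submodule.span_induction with
      | mem x hx =>
        obtain ⟨j, rfl⟩ := hx
        simp [coeff_X, Finsupp.single_left_inj]
      | zero => simp
      | add x y _ _ hx hy =>
        conv_lhs => rw [hx, hy]
        simp [add_smul, Finset.sum_add_distrib]
      | smul c x _ hx =>
        conv_lhs => rw [hx]
        simp [Finset.smul_sum, mul_smul]
    apply hu.1
    rw [h0 u (hspan hu.2)]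
    simp [h]
  set lam : MvPolynomial (Fin n) F →ₗ[F] F :=
    (coeff (Finsupp.single p 1) u)⁻¹ • lcoeff F (Finsupp.single p 1) with hlam
  set φ : MvPolynomial (Fin n) F →ₐ[F] MvPolynomial (Fin n) F :=
    aeval (fun i => X i - lam (X i) • u) with hφ
  have hlin : ∀ g : MvPolynomial (Fin n) F, g.IsHomogeneous 1 → φ g = g - lam g • u := by
    intro g hg
    have hg' := hspan hg
    induction hg' using Submodule.span_induction with
    | mem x hx =>
      obtain ⟨j, rfl⟩ := hx
      simp [hφ]
    | zero => simp
    | add x y hx hy ihx ihy =>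
      rw [← homogeneousSubmodule_one_eq_span_X] at hx hy
      rw [map_add, map_add, ihx hx, ihy hy, add_smul]
      ring
    | smul c x hx ihx =>
      rw [← homogeneousSubmodule_one_eq_span_X] at hx
      rw [map_smul, map_smul, ihx hx, smul_sub, smul_assoc]
  have hhom : ∀ i, (X i - lam (X i) • u).IsHomogeneous 1 := fun i =>
    (isHomogeneous_X F i).sub (Submodule.smul_mem (homogeneousSubmodule (Fin n) F 1) _ hu.2)
  have haeval {k : ℕ} {g : MvPolynomial (Fin n) F} (hg : g.IsHomogeneous k) :
      (φ g).IsHomogeneous k := by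
    have := hg.aeval _ hhom
    rwa [one_mul] at this
  refine ⟨φ, ?_, ?_, fun g hg => ⟨haeval hg, _, hlin g hg⟩, fun g => ?_⟩
  · rw [hlin u hu.2]
    simp [hlam, hp]
  · intro g
    rw [← Ideal.mem_span_singleton, ← Ideal.Quotient.mk_eq_mk_iff_sub_mem]
    have : Ideal.Quotient.mkₐ F (Ideal.span {u}) =
        (Ideal.Quotient.mkₐ F (Ideal.span {u})).comp φ := by
      ext i
      simp only [hφ, AlgHom.comp_apply, aeval_X, Ideal.Quotient.mkₐ_eq_mk]
      rw [Ideal.Quotient.mk_eq_mk_iff_sub_mem, Ideal.mem_span_singleton, sub_sub_cancel]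
      exact dvd_smul_of_dvd _ dvd_rfl
    exact DFunLike.congr_fun this g
  · conv_lhs => rw [← sum_homogeneousComponent g, map_sum]
    refine totalDegree_finsetSum_le fun i hi => ?_
    have := (haeval (homogeneousComponent_isHomogeneous i g)).totalDegree_le
    have := Finset.mem_range.1 hi
    omega

theorem IsLinearForm.prime {u : MvPolynomial (Fin n) F} (hu : IsLinearForm u) : Prime u := by
  obtain ⟨φ, hφu, hφ, -, -⟩ := hu.exists_retraction
  have hdvd {g : MvPolynomial (Fin n) F} (h : φ g = 0) : u ∣ g := by simpa [h] using hφ g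
  refine ⟨hu.1, fun hunit => ?_, fun a b ⟨k, hk⟩ => ?_⟩
  · exact not_isUnit_zero (hφu ▸ hunit.map φ)
  · have : φ a * φ b = 0 := by rw [← map_mul, hk, map_mul, hφu, zero_mul]
    exact (mul_eq_zero.1 this).imp hdvd hdvd

/-- Elimination of two variables by means of the equations `ℓ₁ = ℓ₂ = 0`. -/
theorem exists_retraction_pair {ℓ₁ ℓ₂ : MvPolynomial (Fin n) F} (h₁ : IsLinearForm ℓ₁)
    (h₂ : IsLinearForm ℓ₂) :
    ∃ ψ : MvPolynomial (Fin n) F →ₐ[F] MvPolynomial (Fin n) F,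
      (∀ g, ψ g = 0 ↔ g ∈ Ideal.span {ℓ₁, ℓ₂}) ∧
      ∀ g, g.IsHomogeneous 1 →
        (ψ g).IsHomogeneous 1 ∧ (ψ g = 0 → g ∈ Submodule.span F {ℓ₁, ℓ₂}) := by
  obtain ⟨φ, hφ₁, hφ, hφlin, -⟩ := h₁.exists_retraction
  obtain ⟨hφ₂hom, c₂, hc₂⟩ := hφlin ℓ₂ h₂.2
  obtain ⟨χ, hχ₂, hχ, hχlin⟩ : ∃ χ : MvPolynomial (Fin n) F →ₐ[F] MvPolynomial (Fin n) F,
      χ (φ ℓ₂) = 0 ∧ (∀ g, φ ℓ₂ ∣ g - χ g) ∧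
      ∀ g, g.IsHomogeneous 1 → (χ g).IsHomogeneous 1 ∧ ∃ c : F, χ g = g - c • φ ℓ₂ := by
    by_cases h0 : φ ℓ₂ = 0
    · exact ⟨AlgHom.id F _, by simpa using h0, by simp, fun g hg => ⟨hg, 0, by simp⟩⟩
    · obtain ⟨χ, h1, h2, h3, -⟩ := IsLinearForm.exists_retraction ⟨h0, hφ₂hom⟩
      exact ⟨χ, h1, h2, h3⟩
  have hm₁ : ℓ₁ ∈ Ideal.span {ℓ₁, ℓ₂} := Ideal.subset_span (by simp)
  have hm₂ : ℓ₂ ∈ Ideal.span {ℓ₁, ℓ₂} := Ideal.subset_span (by simp)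
  have hs₁ : ℓ₁ ∈ Submodule.span F {ℓ₁, ℓ₂} := Submodule.subset_span (by simp)
  have hs₂ : ℓ₂ ∈ Submodule.span F {ℓ₁, ℓ₂} := Submodule.subset_span (by simp)
  refine ⟨χ.comp φ, fun g => ⟨fun hg => ?_, fun hg => ?_⟩, fun g hg => ?_⟩
  · have hφmem {k : MvPolynomial (Fin n) F} : k - φ k ∈ Ideal.span {ℓ₁, ℓ₂} :=
      Ideal.mem_of_dvd _ (hφ k) hm₁
    have hφ₂ : φ ℓ₂ ∈ Ideal.span {ℓ₁, ℓ₂} := by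
      simpa using Ideal.sub_mem _ hm₂ (hφmem (k := ℓ₂))
    have h2 : φ g ∈ Ideal.span {ℓ₁, ℓ₂} := by
      have := Ideal.mem_of_dvd _ (hχ (φ g)) hφ₂
      rwa [show χ (φ g) = 0 from hg, sub_zero] at this
    simpa using Ideal.add_mem _ (hφmem (k := g)) h2
  · obtain ⟨a, b, rfl⟩ := Ideal.mem_span_pair.1 hg
    simp [hφ₁, hχ₂]
  · obtain ⟨hhom, c, hc⟩ := hφlin g hg
    obtain ⟨hhom', c', hc'⟩ := hχlin _ hhom
    refine ⟨hhom', fun h0 => ?_⟩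
    rw [AlgHom.comp_apply, hc', hc, hc₂, sub_eq_zero, sub_eq_iff_eq_add] at h0
    rw [h0]
    exact add_mem (Submodule.smul_mem _ _ (sub_mem hs₂ (Submodule.smul_mem _ _ hs₁)))
      (Submodule.smul_mem _ _ hs₁)

theorem IsLinearForm.associated_of_dvd {u v : MvPolynomial (Fin n) F} (hu : IsLinearForm u)
    (hv : IsLinearForm v) (h : u ∣ v) : Associated u v :=
  hu.prime.irreducible.associated_of_dvd hv.prime.irreducible h

theorem exists_smul_eq_of_associated {u v : MvPolynomial (Fin n) F} (h : Associated u v) :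
    ∃ c : F, c ≠ 0 ∧ v = c • u := by
  obtain ⟨w, rfl⟩ := h
  obtain ⟨c, hc, hw⟩ := isUnit_iff_eq_C_of_isReduced.1 w.isUnit
  exact ⟨c, hc.ne_zero, by rw [hw, smul_eq_C_mul, mul_comm]⟩

/-- A nonzero polynomial has at most `totalDegree` many linear factors, up to scalars. -/
theorem ncard_le_totalDegree {α : Type*} {C : Set α} (hC : C.Finite)
    {g : MvPolynomial (Fin n) F} (hg : g ≠ 0) (v : α → MvPolynomial (Fin n) F)
    (hlin : ∀ w ∈ C, IsLinearForm (v w)) (hdvd : ∀ w ∈ C, v w ∣ g)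
    (hinj : ∀ w ∈ C, ∀ w' ∈ C, Associated (v w) (v w') → w = w') :
    C.ncard ≤ g.totalDegree := by
  classical
  obtain ⟨s, rfl⟩ := hC.exists_finset_coe
  have hprod : ∀ t ⊆ s, ∏ w ∈ t, v w ∣ g ∧ (∏ w ∈ t, v w).totalDegree = t.card := by
    intro t
    induction t using Finset.induction_on with
    | empty => simp
    | insert w t hw ih =>
      intro hts
      obtain ⟨hws, hts⟩ := Finset.insert_subset_iff.1 hts
      obtain ⟨⟨k, hk⟩, hdeg⟩ := ih hts
      have hnot : ¬ v w ∣ ∏ w' ∈ t, v w' := by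
        intro hd
        obtain ⟨w', hw', hd'⟩ := (hlin w hws).prime.exists_mem_finset_dvd hd
        obtain rfl := hinj w hws w' (hts hw')
          ((hlin w hws).associated_of_dvd (hlin w' (hts hw')) hd')
        exact hw hw'
      have hne : ∏ w' ∈ t, v w' ≠ 0 := fun h0 => hg (by rw [hk, h0, zero_mul])
      rw [Finset.prod_insert hw, Finset.card_insert_of_notMem hw]
      constructor
      · have hd := hdvd w hws
        rw [hk] at hd ⊢
        rw [mul_comm]
        exact mul_dvd_mul_left _ (((hlin w hws).prime.dvd_or_dvd hd).resolve_left hnot)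
      · rw [totalDegree_mul_of_isDomain (hlin w hws).1 hne, hdeg, (hlin w hws).totalDegree_eq,
          add_comm]
  obtain ⟨hd, hdeg⟩ := hprod s subset_rfl
  rw [Set.ncard_coe_finset, ← hdeg]
  exact totalDegree_le_of_dvd_of_isDomain hd hg

/-- The number of codimension-2 subspaces contained in a given hyperplane `x = 0` on which a
polynomial without linear factors vanishes is at most the degree of the polynomial. -/
theorem NoLinearFactor.ncard_le_totalDegree [Finite F] {h x : MvPolynomial (Fin n) F}
    (hh : NoLinearFactor h) (hx : IsLinearForm x) :
    {W : Set (Fin n → F) | ∃ ℓ₁ ℓ₂ : MvPolynomial (Fin n) F,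
      IsLinearForm ℓ₁ ∧ IsLinearForm ℓ₂ ∧ LinearIndependent F ![ℓ₁, ℓ₂] ∧
      W = {a : Fin n → F | eval a ℓ₁ = 0 ∧ eval a ℓ₂ = 0} ∧
      h ∈ Ideal.span {ℓ₁, ℓ₂} ∧ x ∈ Submodule.span F {ℓ₁, ℓ₂}}.ncard ≤ h.totalDegree := by
  classical
  obtain ⟨φ, hφx, hφ, hφlin, hφdeg⟩ := hx.exists_retraction
  have hφh : φ h ≠ 0 := fun h0 => hh x hx (by simpa [h0] using hφ h)
  have key {ℓ₁ ℓ₂ : MvPolynomial (Fin n) F} (h₁ : IsLinearForm ℓ₁)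
      (hind : LinearIndependent F ![ℓ₁, ℓ₂]) (hmem : h ∈ Ideal.span {ℓ₁, ℓ₂}) {α β : F}
      (hβ : β ≠ 0) (hαβ : α • ℓ₁ + β • ℓ₂ = x) :
      ∃ v, IsLinearForm v ∧ v ∣ φ h ∧ {a : Fin n → F | eval a ℓ₁ = 0 ∧ eval a ℓ₂ = 0} =
        {a : Fin n → F | eval a x = 0 ∧ eval a v = 0} := by
    obtain ⟨hhom, c, hc⟩ := hφlin ℓ₁ h₁.2
    have hne : φ ℓ₁ ≠ 0 := by
      intro h0
      rw [h0, ← hαβ] at hc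
      have h1 : (1 - c * α) • ℓ₁ + (-(c * β)) • ℓ₂ = 0 := by
        rw [hc]
        simp only [smul_eq_C_mul, map_sub, map_neg, map_mul, map_one]
        ring
      obtain ⟨e1, e2⟩ := LinearIndependent.pair_iff.1 hind _ _ h1
      have hc0 : c = 0 := by simpa [hβ] using e2
      simp [hc0] at e1
    refine ⟨φ ℓ₁, ⟨hne, hhom⟩, ?_, ?_⟩
    · have hφ₂ : φ ℓ₂ = (-(β⁻¹ * α)) • φ ℓ₁ := by
        have h2 : α • φ ℓ₁ + β • φ ℓ₂ = 0 := by rw [← hφx, ← hαβ]; simp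
        have h3 : β • φ ℓ₂ = -(α • φ ℓ₁) := by rw [← sub_eq_zero, ← h2]; ring
        rw [← inv_smul_smul₀ hβ (φ ℓ₂), h3, smul_neg, neg_smul, mul_smul]
      obtain ⟨a, b, rfl⟩ := Ideal.mem_span_pair.1 hmem
      rw [map_add, map_mul, map_mul, hφ₂]
      exact dvd_add (Dvd.intro_left _ rfl)
        (Dvd.dvd.mul_left (dvd_smul_of_dvd _ dvd_rfl) _)
    · ext a
      simp only [Set.mem_ofPred_eq, hc, ← hαβ, map_sub, map_add, smul_eval]
      constructor
      · rintro ⟨e1, e2⟩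
        simp [e1, e2]
      · rintro ⟨e1, e2⟩
        rw [e1, mul_zero, sub_zero] at e2
        rw [e2, mul_zero, zero_add] at e1
        exact ⟨e2, (mul_eq_zero.1 e1).resolve_left hβ⟩
  have hex : ∀ W ∈ {W : Set (Fin n → F) | ∃ ℓ₁ ℓ₂ : MvPolynomial (Fin n) F,
      IsLinearForm ℓ₁ ∧ IsLinearForm ℓ₂ ∧ LinearIndependent F ![ℓ₁, ℓ₂] ∧
      W = {a : Fin n → F | eval a ℓ₁ = 0 ∧ eval a ℓ₂ = 0} ∧
      h ∈ Ideal.span {ℓ₁, ℓ₂} ∧ x ∈ Submodule.span F {ℓ₁, ℓ₂}},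
      ∃ v, IsLinearForm v ∧ v ∣ φ h ∧ W = {a : Fin n → F | eval a x = 0 ∧ eval a v = 0} := by
    rintro W ⟨ℓ₁, ℓ₂, h₁, h₂, hind, rfl, hmem, hxmem⟩
    obtain ⟨α, β, hαβ⟩ := Submodule.mem_span_pair.1 hxmem
    by_cases hβ : β = 0
    · have hα : α ≠ 0 := by
        rintro rfl
        exact hx.1 (by rw [← hαβ, hβ]; simp)
      rw [Set.pair_comm] at hmem
      obtain ⟨v, hv, hd, he⟩ := key h₂ (LinearIndependent.pair_symm_iff.1 hind) hmem hα
        (by rw [add_comm]; exact hαβ)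
      exact ⟨v, hv, hd, by rw [← he]; simp only [and_comm]⟩
    · exact key h₁ hind hmem hβ hαβ
  choose! v hv hd he using hex
  refine (_root_.ncard_le_totalDegree (Set.toFinite _) hφh v hv hd ?_).trans (hφdeg h)
  intro W hW W' hW' hass
  obtain ⟨c, hc, hvv⟩ := exists_smul_eq_of_associated hass
  rw [he W hW, he W' hW', hvv]
  simp [smul_eval, hc]

theorem NoLinearFactor.dvd_of_dvd_mul {h P k : MvPolynomial (Fin n) F} (hh : NoLinearFactor h)
    (hP : IsProdLinearForms P) (hdvd : h ∣ P * k) : h ∣ k := by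
  obtain ⟨c, L, hc, hL, rfl⟩ := hP
  induction L using Multiset.induction_on generalizing k with
  | empty =>
    rw [Multiset.prod_zero, smul_mul_assoc, one_mul] at hdvd
    rw [← inv_smul_smul₀ hc k]
    exact dvd_smul_of_dvd _ hdvd
  | cons p L ih =>
    rw [Multiset.prod_cons, smul_mul_assoc, mul_comm p, mul_assoc, ← smul_mul_assoc] at hdvd
    obtain ⟨e, he⟩ := ih (fun q hq => hL q (Multiset.mem_cons_of_mem hq)) hdvd
    have hp := hL p (Multiset.mem_cons_self p L)
    obtain ⟨e', rfl⟩ := (hp.prime.dvd_or_dvd (Dvd.intro k he)).resolve_left (hh p hp)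
    exact ⟨e', mul_left_cancel₀ hp.1 (by rw [he]; ring)⟩

theorem smul_multiset_prod_ne_zero_and_isHomogeneous {c : F} (hc : c ≠ 0)
    {A : Multiset (MvPolynomial (Fin n) F)} (hA : ∀ p ∈ A, IsLinearForm p) :
    c • A.prod ≠ 0 ∧ (c • A.prod).IsHomogeneous A.card := by
  refine ⟨smul_ne_zero hc (Multiset.prod_ne_zero fun h0 => (hA 0 h0).1 rfl),
    Submodule.smul_mem (homogeneousSubmodule (Fin n) F A.card) _ ?_⟩
  induction A using Multiset.induction_on with
  | empty => exact isHomogeneous_one _ _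
  | cons p A ih =>
    rw [Multiset.prod_cons, Multiset.card_cons, add_comm]
    exact (hA p (Multiset.mem_cons_self p A)).2.mul
      (ih fun q hq => hA q (Multiset.mem_cons_of_mem hq))

/-- If `c₁ ∏ A + c₂ ∏ B` vanishes on `ℓ₁ = ℓ₂ = 0` while `∏ B` does not, then each linear form in
`A` is proportional, modulo `ℓ₁, ℓ₂`, to one in `B`. -/
theorem exists_mem_span_pair_of_add_mem {ℓ₁ ℓ₂ : MvPolynomial (Fin n) F} {c₁ c₂ : F}
    {A B : Multiset (MvPolynomial (Fin n) F)} (h₁ : IsLinearForm ℓ₁) (h₂ : IsLinearForm ℓ₂)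
    (hA : ∀ p ∈ A, IsLinearForm p) (hB : ∀ p ∈ B, IsLinearForm p)
    (hAB : ∀ a ∈ A, ∀ b ∈ B, ¬ Associated a b)
    (hadd : c₁ • A.prod + c₂ • B.prod ∈ Ideal.span {ℓ₁, ℓ₂})
    (hnA : c₁ • A.prod ∉ Ideal.span {ℓ₁, ℓ₂}) (hnB : c₂ • B.prod ∉ Ideal.span {ℓ₁, ℓ₂}) :
    ∀ a ∈ A, ∃ b ∈ B, ∃ x ≠ 0,
      x ∈ Submodule.span F {ℓ₁, ℓ₂} ∧ x ∈ Submodule.span F {a, b} := by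
  intro a ha
  obtain ⟨ψ, hψ, hψlin⟩ := exists_retraction_pair h₁ h₂
  rw [← hψ] at hadd hnA hnB
  have hne {c : F} {L : Multiset (MvPolynomial (Fin n) F)} (h0 : ψ (c • L.prod) ≠ 0)
      {p : MvPolynomial (Fin n) F} (hp : p ∈ L) : ψ p ≠ 0 := by
    intro hp0
    obtain ⟨k, hk⟩ := Multiset.dvd_prod hp
    exact h0 (by rw [hk, map_smul, map_mul, hp0, zero_mul, smul_zero])
  have hψa : IsLinearForm (ψ a) := ⟨hne hnA ha, (hψlin a (hA a ha).2).1⟩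
  have hc₂ : c₂ ≠ 0 := by
    rintro rfl
    simp at hnB
  have hdvd : ψ a ∣ ψ B.prod := by
    have h1 : ψ a ∣ ψ (c₁ • A.prod) := by
      rw [map_smul]
      exact dvd_smul_of_dvd _ (map_dvd ψ (Multiset.dvd_prod ha))
    have h2 : ψ a ∣ ψ (c₂ • B.prod) := by
      rw [map_add] at hadd
      exact (dvd_add_right h1).1 (hadd ▸ dvd_zero _)
    rw [map_smul] at h2
    rw [← inv_smul_smul₀ hc₂ (ψ B.prod)]
    exact dvd_smul_of_dvd _ h2
  rw [map_multiset_prod] at hdvd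
  obtain ⟨b, hb, hab⟩ := hψa.prime.exists_mem_multiset_map_dvd hdvd
  obtain ⟨c, hc, hcb⟩ := exists_smul_eq_of_associated
    (hψa.associated_of_dvd ⟨hne hnB hb, (hψlin b (hB b hb).2).1⟩ hab)
  refine ⟨b, hb, b - c • a, fun h0 => ?_, ?_, ?_⟩
  · refine hAB a ha b hb ((hA a ha).associated_of_dvd (hB b hb) ?_)
    rw [sub_eq_zero.1 h0]
    exact dvd_smul_of_dvd _ dvd_rfl
  · refine (hψlin _ ((hB b hb).2.sub
      (Submodule.smul_mem (homogeneousSubmodule (Fin n) F 1) c (hA a ha).2))).2 ?_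
    rw [map_sub, map_smul, hcb, sub_self]
  · exact sub_mem (Submodule.subset_span (by simp))
      (Submodule.smul_mem _ _ (Submodule.subset_span (by simp)))

theorem span_linear_factors_le {c₁ c₂ : F} (hc₁ : c₁ ≠ 0) (hc₂ : c₂ ≠ 0)
    {A B : Multiset (MvPolynomial (Fin n) F)}
    (hA : ∀ p ∈ A, IsLinearForm p) (hB : ∀ p ∈ B, IsLinearForm p) :
    Submodule.span F {ℓ : MvPolynomial (Fin n) F |
        IsLinearForm ℓ ∧ ℓ ∣ (c₁ • A.prod) * (c₂ • B.prod)} ≤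
      Submodule.span F ({p | p ∈ A} ∪ {p | p ∈ B}) := by
  rw [Submodule.span_le]
  rintro ℓ ⟨hℓ, hdvd⟩
  have hmem {c : F} (hc : c ≠ 0) {L : Multiset (MvPolynomial (Fin n) F)}
      (hL : ∀ p ∈ L, IsLinearForm p) (hd : ℓ ∣ c • L.prod) : ∃ p ∈ L, ∃ e : F, ℓ = e • p := by
    have hd' : ℓ ∣ L.prod := by
      rw [← inv_smul_smul₀ hc L.prod]
      exact dvd_smul_of_dvd _ hd
    obtain ⟨p, hp, hdp⟩ := hℓ.prime.exists_mem_multiset_dvd hd'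
    obtain ⟨e, -, he⟩ := exists_smul_eq_of_associated (hℓ.associated_of_dvd (hL p hp) hdp).symm
    exact ⟨p, hp, e, he⟩
  rcases hℓ.prime.dvd_or_dvd hdvd with hd | hd
  · obtain ⟨p, hp, e, rfl⟩ := hmem hc₁ hA hd
    exact Submodule.smul_mem _ _ (Submodule.subset_span (Or.inl hp))
  · obtain ⟨p, hp, e, rfl⟩ := hmem hc₂ hB hd
    exact Submodule.smul_mem _ _ (Submodule.subset_span (Or.inr hp))

end LinearForms

/-- Lemma (size bound), Part 2: the number of codimension-2 subspaces
`W ∈ S(NonLin(f))` on which neither `T₁` nor `T₂` vanishes is at most `d⁵ + d⁷`. -/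
theorem count_codim2_no_gate_vanishes
    {F : Type*} [Field F] [Fintype F] {n d m : ℕ}
    (G T₁ T₂ f h : MvPolynomial (Fin n) F)
    (hd : 1 ≤ d) (hmd : m ≤ d)
    (hG : IsProdLinearForms G) (hT₁ : IsProdLinearForms T₁) (hT₂ : IsProdLinearForms T₂)
    (hT₁hom : T₁.IsHomogeneous m) (hT₂hom : T₂.IsHomogeneous m)
    (hgcd : ∀ ℓ : MvPolynomial (Fin n) F, IsLinearForm ℓ → ℓ ∣ T₁ → ¬ ℓ ∣ T₂)
    (hrank : 5 ≤ Module.finrank F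
      ↥(Submodule.span F {ℓ : MvPolynomial (Fin n) F | IsLinearForm ℓ ∧ ℓ ∣ T₁ * T₂}))
    (hf : f = G * (T₁ + T₂)) (hh : IsNonLinPart f h) :
    {W : Set (Fin n → F) | ∃ ℓ₁ ℓ₂ : MvPolynomial (Fin n) F,
      IsLinearForm ℓ₁ ∧ IsLinearForm ℓ₂ ∧ LinearIndependent F ![ℓ₁, ℓ₂] ∧
      W = {a : Fin n → F | eval a ℓ₁ = 0 ∧ eval a ℓ₂ = 0} ∧
      h ∈ Ideal.span {ℓ₁, ℓ₂} ∧
      T₁ ∉ Ideal.span {ℓ₁, ℓ₂} ∧ T₂ ∉ Ideal.span {ℓ₁, ℓ₂}}.ncard ≤ d ^ 5 + d ^ 7 := by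
  classical
  obtain ⟨hhN, L, hL, hfL⟩ := hh
  obtain ⟨c₁, A, hc₁, hA, rfl⟩ := hT₁
  obtain ⟨c₂, B, hc₂, hB, rfl⟩ := hT₂
  have hdvd : h ∣ c₁ • A.prod + c₂ • B.prod :=
    hhN.dvd_of_dvd_mul hG ⟨L, by rw [← hf, hfL, mul_comm]⟩
  have hfactor {c : F} {M : Multiset (MvPolynomial (Fin n) F)} {p : MvPolynomial (Fin n) F}
      (hp : p ∈ M) : p ∣ c • M.prod := dvd_smul_of_dvd _ (Multiset.dvd_prod hp)
  have hAB : ∀ a ∈ A, ∀ b ∈ B, ¬ Associated a b := fun a ha b hb hab =>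
    hgcd a (hA a ha) (hfactor ha) (hab.dvd.trans (hfactor hb))
  have hAprod := smul_multiset_prod_ne_zero_and_isHomogeneous hc₁ hA
  have hBprod := smul_multiset_prod_ne_zero_and_isHomogeneous hc₂ hB
  have hAcard : A.card = m := hAprod.2.inj_right hT₁hom hAprod.1
  have hBcard : B.card = m := hBprod.2.inj_right hT₂hom hBprod.1
  have hrank' : 5 ≤ Module.finrank F (Submodule.span F ({p | p ∈ A} ∪ {p | p ∈ B})) := by
    have hfin : FiniteDimensional F (Submodule.span F ({p | p ∈ A} ∪ {p | p ∈ B})) :=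
      FiniteDimensional.span_of_finite F (A.finite_toSet.union B.finite_toSet)
    exact hrank.trans (Submodule.finrank_mono (span_linear_factors_le hc₁ hc₂ hA hB))
  have hsum : c₁ • A.prod + c₂ • B.prod ≠ 0 := by
    intro h0
    obtain ⟨a, ha⟩ : ∃ a, a ∈ A := by
      refine Multiset.exists_mem_of_ne_zero fun hA0 => ?_
      have hB0 : B = 0 := by rw [← Multiset.card_eq_zero, hBcard, ← hAcard, hA0, Multiset.card_zero]
      have hAB0 : ({p | p ∈ A} ∪ {p | p ∈ B} : Set (MvPolynomial (Fin n) F)) = ∅ := by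
        simp [hA0, hB0]
      rw [hAB0, Submodule.span_empty, finrank_bot] at hrank'
      omega
    exact hgcd a (hA a ha) (hfactor ha) ((dvd_add_right (hfactor ha)).1 (h0 ▸ dvd_zero a))
  have hdeg : h.totalDegree ≤ d :=
    (totalDegree_le_of_dvd_of_isDomain hdvd hsum).trans
      ((hT₁hom.add hT₂hom).totalDegree_le.trans hmd)
  obtain ⟨P, hP⟩ : ∃ P, P = A.toFinset ×ˢ B.toFinset := ⟨_, rfl⟩
  have hPcard : P.card ≤ d * d := by
    rw [hP, Finset.card_product]
    exact Nat.mul_le_mul ((Multiset.toFinset_card_le A).trans (hAcard.trans_le hmd))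
      ((Multiset.toFinset_card_le B).trans (hBcard.trans_le hmd))
  let S : (MvPolynomial (Fin n) F × MvPolynomial (Fin n) F) ×
      (MvPolynomial (Fin n) F × MvPolynomial (Fin n) F) ×
      (MvPolynomial (Fin n) F × MvPolynomial (Fin n) F) → Set (Set (Fin n → F)) := fun t =>
    {W | ∃ ℓ₁ ℓ₂ : MvPolynomial (Fin n) F,
      IsLinearForm ℓ₁ ∧ IsLinearForm ℓ₂ ∧ LinearIndependent F ![ℓ₁, ℓ₂] ∧
      W = {a : Fin n → F | eval a ℓ₁ = 0 ∧ eval a ℓ₂ = 0} ∧ h ∈ Ideal.span {ℓ₁, ℓ₂} ∧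
      ¬ (t.2.2.1 ∈ Submodule.span F {t.1.1, t.1.2, t.2.1.1, t.2.1.2} ∧
        t.2.2.2 ∈ Submodule.span F {t.1.1, t.1.2, t.2.1.1, t.2.1.2}) ∧
      ∃ x ≠ 0, x ∈ Submodule.span F {ℓ₁, ℓ₂} ∧ x ∈ Submodule.span F {t.2.2.1, t.2.2.2} ∧
        x ∈ Submodule.span F {t.1.1, t.1.2, t.2.1.1, t.2.1.2}}
  have hS (t) : (S t).ncard ≤ d := by
    rcases (S t).eq_empty_or_nonempty with hempty | hne
    · simp [hempty]
    obtain ⟨W, ℓ₁, ℓ₂, h₁, h₂, -, -, -, hnQ, x, hx0, hxU, hxP, hxQ⟩ := hne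
    have hxlin : IsLinearForm x := by
      refine ⟨hx0, (Submodule.span_le (p := homogeneousSubmodule (Fin n) F 1)).2 ?_ hxU⟩
      rintro z (rfl | rfl)
      exacts [h₁.2, h₂.2]
    refine (Set.ncard_le_ncard ?_ (Set.toFinite _)).trans
      ((hhN.ncard_le_totalDegree hxlin).trans hdeg)
    rintro W' ⟨k₁, k₂, hk₁, hk₂, hind, hW', hmem, -, y, hy0, hyU, hyP, hyQ⟩
    obtain ⟨c, rfl⟩ := exists_smul_eq_of_mem_span_pair hnQ hyP hyQ hy0 hxP hxQ
    exact ⟨k₁, k₂, hk₁, hk₂, hind, hW', hmem, Submodule.smul_mem _ _ hyU⟩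
  have hcount : (⋃ t ∈ P ×ˢ P ×ˢ P, S t).ncard ≤ d ^ 7 :=
    calc (⋃ t ∈ P ×ˢ P ×ˢ P, S t).ncard
        ≤ ∑ t ∈ P ×ˢ P ×ˢ P, (S t).ncard := Finset.set_ncard_biUnion_le _ _
      _ ≤ (P ×ˢ P ×ˢ P).card * d := Finset.sum_le_card_nsmul _ _ _ fun t _ => hS t
      _ ≤ ((d * d) * ((d * d) * (d * d))) * d := by
        rw [Finset.card_product, Finset.card_product]
        exact Nat.mul_le_mul_right _ (Nat.mul_le_mul hPcard (Nat.mul_le_mul hPcard hPcard))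
      _ = d ^ 7 := by ring
  refine (Set.ncard_le_ncard ?_ (Set.toFinite _)).trans (hcount.trans (Nat.le_add_left _ _))
  rintro W ⟨ℓ₁, ℓ₂, h₁, h₂, hind, hW, hmem, hn₁, hn₂⟩
  have hadd := Ideal.mem_of_dvd _ hdvd hmem
  obtain ⟨a₀, ha₀, b₀, hb₀, a₁, ha₁, b₁, hb₁, a₂, ha₂, b₂, hb₂, hnQ, hx⟩ :=
    exists_mem_span_inter_of_five_le_finrank (A := {p | p ∈ A}) (B := {p | p ∈ B})
      (exists_mem_span_pair_of_add_mem h₁ h₂ hA hB hAB hadd hn₁ hn₂)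
      (fun b hb => by
        obtain ⟨a, ha, x, hx0, hxU, hxP⟩ := exists_mem_span_pair_of_add_mem h₁ h₂ hB hA
          (fun b hb a ha hba => hAB a ha b hb hba.symm) (by rwa [add_comm]) hn₂ hn₁ b hb
        exact ⟨a, ha, x, hx0, hxU, by rwa [Set.pair_comm]⟩) hrank'
  simp only [Set.mem_iUnion]
  refine ⟨((a₀, b₀), (a₁, b₁), (a₂, b₂)), ?_, ℓ₁, ℓ₂, h₁, h₂, hind, hW, hmem, hnQ, hx⟩
  simp only [Set.mem_ofPred_eq] at ha₀ hb₀ ha₁ hb₁ ha₂ hb₂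
  simp [*]
end

section
/- Let T_1, T_2 ∈ F[x_1,…,x_n] be products of linear forms, homogeneous of equal degree m ≥ 1, with no common linear factor (gcd(T_1,T_2) = 1). Then the set of linear factors of T_1 + T_2 spans an F-subspace of dimension at most log₂(m) + 2. -/
open MvPolynomial

section Walk

variable {F V Q ι : Type*} [Field F] [AddCommGroup V] [Module F V] [AddCommGroup Q] [Module F Q]

/-- If every element of a finite set `U` can be moved inside `U` by a nonzero multiple of each
`v i`, and the `f (v i)` are linearly independent, then `U` has at least as many elements as the
index set has subsets, provided that it meets the kernel of `f`. -/
lemma two_pow_card_le_card_of_linearIndependent [Fintype ι] (f : V →ₗ[F] Q) (v : ι → V)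
    (hv : LinearIndependent F (f ∘ v)) (U : Finset V) (a : V) (ha : a ∈ U) (hfa : f a = 0)
    (hU : ∀ p ∈ U, ∀ i, ∃ c d : F, c ≠ 0 ∧ d ≠ 0 ∧ c • p + d • v i ∈ U) :
    2 ^ Fintype.card ι ≤ U.card := by
  classical
  have key : ∀ S : Finset ι, ∃ p ∈ U, ∃ e : ι →₀ F, e.support = S ∧
      f p = Finsupp.linearCombination F (f ∘ v) e := by
    intro S
    induction S using Finset.induction_on with
    | empty => exact ⟨a, ha, 0, by simp, by simp [hfa]⟩
    | insert i S hi ih =>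
      obtain ⟨p, hp, e, rfl, hfp⟩ := ih
      obtain ⟨c, d, hc, hd, hq⟩ := hU p hp i
      refine ⟨_, hq, c • e + Finsupp.single i d, ?_, by simp [hfp]⟩
      have hei : e i = 0 := by simpa using hi
      ext j
      by_cases hj : j = i
      · subst hj
        simp [hei, hd]
      · simp [hj, hc]
  choose p hp e he hfp using key
  have hinj : Function.Injective p := by
    intro S T hST
    have h : e S = e T := hv (by rw [← hfp, ← hfp, hST])
    rw [← he S, ← he T, h]
  have := Finset.card_le_card_of_injOn (s := Finset.univ) p (fun S _ => hp S) hinj.injOn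
  simpa using this

/-- Passing to the quotient by a line drops the dimension of a subspace by at most one. -/
lemma finrank_le_finrank_map_mkQ_span_singleton_add_one (W : Submodule F V) [FiniteDimensional F W]
    (a : V) :
    Module.finrank F W ≤ Module.finrank F (W.map (Submodule.span F {a}).mkQ) + 1 := by
  set g := (Submodule.span F {a}).mkQ.domRestrict W with hg
  have h := g.finrank_range_add_finrank_ker
  have hr : LinearMap.range g = W.map (Submodule.span F {a}).mkQ := by
    rw [hg, LinearMap.range_domRestrict]
  have hk : Module.finrank F (LinearMap.ker g) ≤ 1 := by
    have hmap : (LinearMap.ker g).map W.subtype ≤ Submodule.span F {a} := by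
      rintro _ ⟨x, hx, rfl⟩
      simpa [hg] using hx
    calc Module.finrank F (LinearMap.ker g)
        = Module.finrank F ((LinearMap.ker g).map W.subtype) :=
          (LinearEquiv.finrank_eq
            (Submodule.equivMapOfInjective _ W.injective_subtype _))
      _ ≤ Module.finrank F (Submodule.span F {a}) := Submodule.finrank_mono hmap
      _ ≤ 1 := (finrank_span_le_card ({a} : Set V)).trans_eq (by simp)
  rw [hr] at h
  lia

/-- A spanning set that moves a finite nonempty set `U` into itself, in the sense that every
element of `U` can be moved inside `U` by a nonzero multiple of each vector of the set, spans a
space of dimension at most `log₂ |U| + 1`. -/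
lemma two_pow_finrank_span_le (s : Set V) [FiniteDimensional F (Submodule.span F s)]
    (U : Finset V) (hne : U.Nonempty)
    (hU : ∀ p ∈ U, ∀ v ∈ s, ∃ c d : F, c ≠ 0 ∧ d ≠ 0 ∧ c • p + d • v ∈ U) :
    2 ^ Module.finrank F (Submodule.span F s) ≤ 2 * U.card := by
  obtain ⟨a, ha⟩ := hne
  have hle := finrank_le_finrank_map_mkQ_span_singleton_add_one (Submodule.span F s) a
  set f := (Submodule.span F {a}).mkQ with hf
  have hfd : FiniteDimensional F ((Submodule.span F s).map f) := inferInstance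
  rw [Submodule.map_span] at hle hfd
  obtain ⟨b, hbs, hb, hli⟩ := exists_linearIndependent F (f '' s)
  rw [← hb] at hle hfd
  have hli' : LinearIndependent F (fun x : b =>
      (⟨x, Submodule.subset_span x.2⟩ : Submodule.span F b)) :=
    LinearIndependent.of_comp (Submodule.span F b).subtype hli
  have := hli'.finite
  have := Fintype.ofFinite b
  choose v hvs hv using fun x : b => hbs x.2
  have hfv : f ∘ v = fun x : b => (x : V ⧸ Submodule.span F {a}) := funext hv
  have hcard := two_pow_card_le_card_of_linearIndependent f v (hfv ▸ hli) U a ha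
    (by simp [hf]) (fun p hp i => hU p hp _ (hvs i))
  have hfin : Module.finrank F (Submodule.span F b) = Fintype.card b := by
    rw [finrank_span_set_eq_card hli, Set.toFinset_card]
  rw [hfin] at hle
  calc 2 ^ Module.finrank F (Submodule.span F s) ≤ 2 ^ (Fintype.card b + 1) :=
        Nat.pow_le_pow_right two_pos hle
    _ ≤ 2 * U.card := by rw [pow_succ]; lia

end Walk

section LinearForms

variable {F : Type*} [Field F] {n : ℕ}

/-- There is an algebra endomorphism that kills exactly those linear forms that lie in a given
subspace. -/
lemma exists_algHom_apply_eq_zero_iff (W : Submodule F (MvPolynomial (Fin n) F)) :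
    ∃ φ : MvPolynomial (Fin n) F →ₐ[F] MvPolynomial (Fin n) F,
      ∀ p : MvPolynomial (Fin n) F, p.IsHomogeneous 1 → (φ p = 0 ↔ p ∈ W) := by
  obtain ⟨g, hg⟩ := W.mkQ.exists_rightInverse_of_surjective W.range_mkQ
  have hginj : Function.Injective g :=
    Function.LeftInverse.injective (g := W.mkQ) fun x => LinearMap.congr_fun hg x
  let φ := aeval (R := F) fun i : Fin n => g (W.mkQ (X i))
  refine ⟨φ, fun p hp => ?_⟩
  have hφ : Set.EqOn φ.toLinearMap (g ∘ₗ W.mkQ)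
      (Submodule.span F (Set.range (X : Fin n → MvPolynomial (Fin n) F))) := by
    apply LinearMap.eqOn_span
    rintro _ ⟨i, rfl⟩
    simp [φ]
  have hφp : φ p = g (W.mkQ p) := hφ (by
    rw [← homogeneousSubmodule_one_eq_span_X]
    exact hp)
  rw [hφp, map_eq_zero_iff g hginj]
  simp

/-- If `T` plus a product of linear forms is divisible by a linear form `ℓ`, then each linear factor
of `T` becomes, modulo `ℓ`, proportional to one of these linear forms. -/
lemma exists_mem_smul_add_smul {T p ℓ : MvPolynomial (Fin n) F} {c : F} (hc : c ≠ 0)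
    {L : Multiset (MvPolynomial (Fin n) F)} (hL : ∀ q ∈ L, IsLinearForm q)
    (hp : IsLinearForm p) (hpT : p ∣ T) (hℓ : IsLinearForm ℓ) (hdvd : ℓ ∣ T + c • L.prod)
    (hgcd : ∀ q : MvPolynomial (Fin n) F, IsLinearForm q → q ∣ T → ¬ q ∣ c • L.prod) :
    ∃ a d : F, a ≠ 0 ∧ d ≠ 0 ∧ a • p + d • ℓ ∈ L := by
  obtain ⟨φ, hφ⟩ := exists_algHom_apply_eq_zero_iff (Submodule.span F {p, ℓ})
  have hφp : φ p = 0 := (hφ p hp.2).2 (Submodule.subset_span (by simp))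
  have hφℓ : φ ℓ = 0 := (hφ ℓ hℓ.2).2 (Submodule.subset_span (by simp))
  have hφT : φ T = 0 := zero_dvd_iff.1 (hφp ▸ map_dvd φ hpT)
  have hφL : φ L.prod = 0 := by
    have h := zero_dvd_iff.1 (hφℓ ▸ map_dvd φ hdvd)
    simpa [hφT, hc] using h
  rw [map_multiset_prod, Multiset.prod_eq_zero_iff, Multiset.mem_map] at hφL
  obtain ⟨q, hq, hφq⟩ := hφL
  obtain ⟨a, d, rfl⟩ := Submodule.mem_span_pair.1 ((hφ q (hL q hq).2).1 hφq)
  have hqL : a • p + d • ℓ ∣ c • L.prod :=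
    (Multiset.dvd_prod hq).trans (Dvd.intro_left (C c) (smul_eq_C_mul _ _).symm)
  refine ⟨a, d, ?_, ?_, hq⟩
  · rintro rfl
    rw [zero_smul, zero_add] at hqL
    have hℓL := (dvd_smul_of_dvd d dvd_rfl).trans hqL
    exact hgcd ℓ hℓ ((dvd_add_left hℓL).1 hdvd) hℓL
  · rintro rfl
    rw [zero_smul, add_zero] at hqL
    exact hgcd p hp hpT ((dvd_smul_of_dvd a dvd_rfl).trans hqL)

lemma isHomogeneous_multiset_prod {L : Multiset (MvPolynomial (Fin n) F)}
    (hL : ∀ q ∈ L, IsLinearForm q) : L.prod.IsHomogeneous L.card := by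
  induction L using Multiset.induction_on with
  | empty => simpa using isHomogeneous_one (Fin n) F
  | cons q L ih =>
    rw [Multiset.prod_cons, Multiset.card_cons, add_comm]
    exact (hL q (by simp)).2.mul (ih fun r hr => hL r (Multiset.mem_cons_of_mem hr))

lemma card_eq_of_isHomogeneous_smul_prod {L : Multiset (MvPolynomial (Fin n) F)} {c : F} {m : ℕ}
    (hc : c ≠ 0) (hL : ∀ q ∈ L, IsLinearForm q) (h : (c • L.prod).IsHomogeneous m) :
    L.card = m := by
  have h0 : c • L.prod ≠ 0 := smul_ne_zero hc <| Multiset.prod_ne_zero fun h => (hL 0 h).1 rfl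
  exact ((homogeneousSubmodule (Fin n) F _).smul_mem c (isHomogeneous_multiset_prod hL)).inj_right
    h h0

end LinearForms

/-- The linear factors of `T₁ + T₂` span a space of dimension at most `log₂ m + 2`. -/
theorem dim_span_linear_factors_of_sum_le
    {F : Type*} [Field F] [Fintype F] {n m : ℕ}
    (T₁ T₂ : MvPolynomial (Fin n) F)
    (hm : 1 ≤ m)
    (hT₁ : IsProdLinearForms T₁) (hT₂ : IsProdLinearForms T₂)
    (hT₁hom : T₁.IsHomogeneous m) (hT₂hom : T₂.IsHomogeneous m)
    (hgcd : ∀ ℓ : MvPolynomial (Fin n) F, IsLinearForm ℓ → ℓ ∣ T₁ → ¬ ℓ ∣ T₂) :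
    (Module.finrank F
      ↥(Submodule.span F {ℓ : MvPolynomial (Fin n) F | IsLinearForm ℓ ∧ ℓ ∣ T₁ + T₂}) : ℝ)
      ≤ Real.logb 2 (m : ℝ) + 2 := by
  classical
  obtain ⟨c₁, L₁, hc₁, hL₁, rfl⟩ := hT₁
  obtain ⟨c₂, L₂, hc₂, hL₂, rfl⟩ := hT₂
  have hcard₁ := card_eq_of_isHomogeneous_smul_prod hc₁ hL₁ hT₁hom
  have hcard₂ := card_eq_of_isHomogeneous_smul_prod hc₂ hL₂ hT₂hom
  set s := {ℓ : MvPolynomial (Fin n) F | IsLinearForm ℓ ∧ ℓ ∣ c₁ • L₁.prod + c₂ • L₂.prod}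
  have : FiniteDimensional F (homogeneousSubmodule (Fin n) F 1) :=
    Module.Finite.iff_fg.2 (homogeneousSubmodule_fg _ F 1)
  have : FiniteDimensional F (Submodule.span F s) :=
    Submodule.finiteDimensional_of_le
      (S₂ := homogeneousSubmodule (Fin n) F 1) (Submodule.span_le.2 fun ℓ hℓ => hℓ.1.2)
  have hne : (L₁ + L₂).toFinset.Nonempty := by
    obtain ⟨p, hp⟩ := Multiset.card_pos_iff_exists_mem.1 (by lia : 0 < L₁.card)
    exact ⟨p, by simp [hp]⟩
  have hdvd {L : Multiset (MvPolynomial (Fin n) F)} {p} (c : F) (hp : p ∈ L) : p ∣ c • L.prod :=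
    dvd_smul_of_dvd c (Multiset.dvd_prod hp)
  have hpow := two_pow_finrank_span_le s (L₁ + L₂).toFinset hne (by
    intro p hp ℓ hℓ
    simp only [Multiset.mem_toFinset, Multiset.mem_add] at hp ⊢
    rcases hp with hp | hp
    · obtain ⟨a, d, ha, hd, h⟩ := exists_mem_smul_add_smul hc₂ hL₂ (hL₁ p hp) (hdvd c₁ hp)
        hℓ.1 hℓ.2 hgcd
      exact ⟨a, d, ha, hd, .inr h⟩
    · obtain ⟨a, d, ha, hd, h⟩ := exists_mem_smul_add_smul hc₁ hL₁ (hL₂ p hp) (hdvd c₂ hp)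
        hℓ.1 (add_comm (c₁ • L₁.prod) _ ▸ hℓ.2) fun q hq h₂ h₁ => hgcd q hq h₁ h₂
      exact ⟨a, d, ha, hd, .inl h⟩)
  have hU := Multiset.toFinset_card_le (L₁ + L₂)
  rw [Multiset.card_add, hcard₁, hcard₂] at hU
  have hle : (2 : ℝ) ^ Module.finrank F (Submodule.span F s) ≤ m * 2 ^ 2 := by
    exact_mod_cast (by lia : 2 ^ Module.finrank F (Submodule.span F s) ≤ m * 2 ^ 2)
  have hm' : (0 : ℝ) < m := by exact_mod_cast hm
  calc (Module.finrank F (Submodule.span F s) : ℝ)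
      = Real.logb 2 (2 ^ Module.finrank F (Submodule.span F s)) := by simp [Real.logb_pow]
    _ ≤ Real.logb 2 (m * 2 ^ 2) := Real.logb_le_logb_of_le one_lt_two (by positivity) hle
    _ = Real.logb 2 m + 2 := by
      rw [Real.logb_mul hm'.ne' (by norm_num), Real.logb_pow]
      simp
end
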